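/- arXiv:2104.06675 — 2 statements merged into one kernel-verified Lean document; each statement's English description precedes it below -/
import Mathlib

section
/- Let d ∈ ℝⁿ, τ > 0, and 1 ≤ K ≤ n. Let S be a set of K indices with the largest values of |d_i|, and define v by v_i = −τ · sign(d_i) for i ∈ S and v_i = 0 otherwise. Then v minimizes the linear function x ↦ ⟨d, x⟩ over the K-sparse polytope C(K, τ) = {x ∈ ℝⁿ : ‖x‖₁ ≤ τK and ‖x‖_∞ ≤ τ}, and the minimum value equals −τ times the sum of the K largest values of |d_i|. -/
/-- `sgn a = 1` if `a ≥ 0` and `-1` otherwise. -/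
noncomputable def sgn (a : ℝ) : ℝ := if 0 ≤ a then 1 else -1

/-- Linear minimization oracle over the K-sparse polytope
`C(K, τ) = {x : ‖x‖₁ ≤ τK, ‖x‖_∞ ≤ τ}`: for a set `S` of `K` indices carrying
the largest values of `|d i|`, the vector `v` with `v i = -τ * sgn (d i)` for
`i ∈ S` and `v i = 0` otherwise lies in `C(K, τ)`, minimizes `x ↦ ⟪d, x⟫` over
`C(K, τ)`, and the minimum value is `-τ` times the sum of the `K` largest
values of `|d i|`. -/
theorem lmo_ksparse_polytope
    {n : ℕ} (d : Fin n → ℝ) (τ : ℝ) (hτ : 0 < τ) (K : ℕ)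
    (hK1 : 1 ≤ K) (hKn : K ≤ n)
    (S : Finset (Fin n)) (hScard : S.card = K)
    (hStop : ∀ i ∈ S, ∀ j ∉ S, |d j| ≤ |d i|)
    (v : Fin n → ℝ)
    (hv : v = fun i => if i ∈ S then -τ * sgn (d i) else 0) :
    ((∑ i, |v i|) ≤ τ * K ∧ ∀ i, |v i| ≤ τ) ∧
    (∀ x : Fin n → ℝ, (∑ i, |x i|) ≤ τ * K → (∀ i, |x i| ≤ τ) →
      ∑ i, d i * v i ≤ ∑ i, d i * x i) ∧
    (∑ i, d i * v i) = -τ * ∑ i ∈ S, |d i| := by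
  have habs : ∀ i, |v i| = if i ∈ S then τ else 0 := by
    intro i
    rw [hv]
    by_cases h : i ∈ S
    · by_cases h2 : 0 ≤ d i <;> simp [h, sgn, h2, abs_of_pos hτ]
    · simp [h]
  have hval : (∑ i, d i * v i) = -τ * ∑ i ∈ S, |d i| := by
    have h1 : ∀ i, d i * v i = if i ∈ S then -τ * |d i| else 0 := by
      intro i
      rw [hv]
      by_cases h : i ∈ S
      · by_cases h2 : 0 ≤ d i
        · simp [h, sgn, h2, abs_of_nonneg h2]; ring
        · simp [h, sgn, h2, abs_of_neg (not_le.mp h2)]; ring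
      · simp [h]
    simp only [h1]
    rw [Finset.sum_ite_mem, Finset.univ_inter, Finset.mul_sum]
  refine ⟨⟨?_, ?_⟩, ?_, hval⟩
  · simp only [habs]
    rw [Finset.sum_ite_mem, Finset.univ_inter, Finset.sum_const, hScard, nsmul_eq_mul, mul_comm]
  · intro i
    rw [habs]
    split_ifs
    · exact le_rfl
    · exact hτ.le
  · intro x hx1 hx2
    rw [hval]
    have hne : S.Nonempty := Finset.card_pos.mp (by omega)
    obtain ⟨k, hk, hmin⟩ := S.exists_min_image (fun i => |d i|) hne
    have hpt : ∀ i, (if i ∈ S then -τ * |d i| + |d k| * τ else 0) - |d k| * |x i| ≤ d i * x i := by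
      intro i
      have h1 : -(|d i| * |x i|) ≤ d i * x i := by
        rw [← abs_mul]; exact neg_abs_le _
      by_cases h : i ∈ S
      · simp only [h, if_true]
        nlinarith [mul_nonneg (sub_nonneg.mpr (hmin i h)) (sub_nonneg.mpr (hx2 i))]
      · simp only [h, if_false]
        nlinarith [mul_le_mul_of_nonneg_right (hStop k hk i h) (abs_nonneg (x i))]
    have hsum := Finset.sum_le_sum (fun i (_ : i ∈ Finset.univ) => hpt i)
    rw [Finset.sum_sub_distrib, Finset.sum_ite_mem, Finset.univ_inter, Finset.sum_add_distrib,
      Finset.sum_const, hScard, nsmul_eq_mul, ← Finset.mul_sum, ← Finset.mul_sum] at hsum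
    nlinarith [mul_le_mul_of_nonneg_left hx1 (abs_nonneg (d k))]
end

section
/- Let C be a nonempty compact convex subset of a real Hilbert space with diameter D = sup_{x,y ∈ C} ‖x − y‖, and let f be convex and L-smooth on C with minimizer x* ∈ C. Let x₀ ∈ C and define Frank-Wolfe iterates x_{t+1} = x_t + γ_t(v_t − x_t) with the agnostic step size γ_t = 2/(t + 2), where v_t ∈ C satisfies ⟨∇f(x_t), v_t⟩ ≤ ⟨∇f(x_t), u⟩ for all u ∈ C. Then for all t ≥ 1, f(x_t) − f(x*) ≤ 2LD²/(t + 1); i.e. the vanilla Frank-Wolfe algorithm converges at rate O(1/t). -/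
open scoped RealInnerProductSpace

/-- Derivative of `f` along the segment. -/
lemma fw_hasDerivAt {E : Type*} [NormedAddCommGroup E] [InnerProductSpace ℝ E] [CompleteSpace E]
    {f : E → ℝ} {g y d : E} {s : ℝ} (h : HasGradientAt f g (y + s • d)) :
    HasDerivAt (fun r : ℝ => f (y + r • d)) ⟪g, d⟫ s := by
  have h1 : HasDerivAt (fun r : ℝ => y + r • d) d s := by
    simpa using ((hasDerivAt_id s).smul_const d).const_add y
  have h2 := h.hasFDerivAt.comp_hasDerivAt s h1
  simp only [InnerProductSpace.toDual_apply_apply] at h2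
  exact h2

/-- Points of the segment lie in `C`. -/
lemma fw_mem {E : Type*} [NormedAddCommGroup E] [InnerProductSpace ℝ E]
    {C : Set E} (hC : Convex ℝ C) {y z : E} (hy : y ∈ C) (hz : z ∈ C) {s : ℝ}
    (h0 : 0 ≤ s) (h1 : s ≤ 1) : y + s • (z - y) ∈ C :=
  hC.add_smul_sub_mem hy hz ⟨h0, h1⟩

/-- The descent lemma. -/
lemma fw_descent {E : Type*} [NormedAddCommGroup E] [InnerProductSpace ℝ E] [CompleteSpace E]
    {C : Set E} (hC : Convex ℝ C) {f : E → ℝ} {f' : E → E} {L : ℝ}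
    (hfdiff : ∀ y ∈ C, HasGradientAt f (f' y) y)
    (hlip : ∀ y ∈ C, ∀ z ∈ C, ‖f' y - f' z‖ ≤ L * ‖y - z‖)
    {y z : E} (hy : y ∈ C) (hz : z ∈ C) {s : ℝ} (h0 : 0 ≤ s) (h1 : s ≤ 1) :
    f (y + s • (z - y)) ≤ f y + s * ⟪f' y, z - y⟫ + L / 2 * s ^ 2 * ‖z - y‖ ^ 2 := by
  set d := z - y with hd
  have hder : ∀ r ∈ Set.Icc (0 : ℝ) 1,
      HasDerivAt (fun r : ℝ => f (y + r • d) - r * ⟪f' y, d⟫ - L / 2 * ‖d‖ ^ 2 * r ^ 2)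
        (⟪f' (y + r • d), d⟫ - ⟪f' y, d⟫ - L * ‖d‖ ^ 2 * r) r := by
    intro r hr
    have a1 := fw_hasDerivAt (hfdiff _ (fw_mem hC hy hz hr.1 hr.2))
    have a2 := (hasDerivAt_id r).mul_const ⟪f' y, d⟫
    have a3 := (hasDerivAt_pow 2 r).const_mul (L / 2 * ‖d‖ ^ 2)
    refine ((a1.sub a2).sub a3).congr_deriv ?_
    simp only [← hd]
    push_cast
    ring
  have hanti : AntitoneOn
      (fun r : ℝ => f (y + r • d) - r * ⟪f' y, d⟫ - L / 2 * ‖d‖ ^ 2 * r ^ 2)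
      (Set.Icc (0 : ℝ) 1) := by
    apply antitoneOn_of_deriv_nonpos (convex_Icc 0 1)
    · exact fun r hr => (hder r hr).continuousAt.continuousWithinAt
    · exact fun r hr => (hder r (interior_subset hr)).differentiableAt.differentiableWithinAt
    · intro r hr
      have hr' := interior_subset hr
      rw [(hder r hr').deriv]
      have b1 := hlip _ (fw_mem hC hy hz hr'.1 hr'.2) _ hy
      rw [← hd] at b1
      have b2 : ⟪f' (y + r • d) - f' y, d⟫ ≤ ‖f' (y + r • d) - f' y‖ * ‖d‖ :=
        real_inner_le_norm _ _
      rw [inner_sub_left] at b2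
      have b3 : ‖y + r • d - y‖ = r * ‖d‖ := by
        rw [add_sub_cancel_left, norm_smul, Real.norm_of_nonneg hr'.1]
      rw [b3] at b1
      have b4 := mul_le_mul_of_nonneg_right b1 (norm_nonneg d)
      nlinarith
  have := hanti (Set.left_mem_Icc.2 zero_le_one) ⟨h0, h1⟩ h0
  simp at this
  linarith

/-- First-order convexity inequality. -/
lemma fw_convex {E : Type*} [NormedAddCommGroup E] [InnerProductSpace ℝ E] [CompleteSpace E]
    {C : Set E} {f : E → ℝ} {g : E} (hf : ConvexOn ℝ C f)
    {y z : E} (hy : y ∈ C) (hz : z ∈ C) (hg : HasGradientAt f g y) :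
    ⟪g, z - y⟫ ≤ f z - f y := by
  have hd : HasDerivAt (fun r : ℝ => f (y + r • (z - y))) ⟪g, z - y⟫ 0 :=
    fw_hasDerivAt (by simpa using hg)
  have hc : ConvexOn ℝ (Set.Icc (0 : ℝ) 1) (fun r : ℝ => f (y + r • (z - y))) := by
    refine ⟨convex_Icc 0 1, fun a ha b hb p q hp hq hpq => ?_⟩
    have := hf.2 (fw_mem hf.1 hy hz ha.1 ha.2) (fw_mem hf.1 hy hz hb.1 hb.2) hp hq hpq
    convert this using 2
    have : q = 1 - p := by linarith
    subst this
    simp only [smul_eq_mul]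
    module
  have := hc.le_slope_of_hasDerivAt (x := 0) (y := 1) (by simp) (by simp) zero_lt_one hd
  simpa [slope_def_field] using this

/-- `O(1/t)` convergence of the vanilla Frank-Wolfe algorithm with the agnostic
step size `γ_t = 2 / (t + 2)`: for `f` convex and `L`-smooth on a nonempty
compact convex set `C` of diameter `D` in a real Hilbert space, with minimizer
`xstar ∈ C`, iterates `x (t+1) = x t + (2 / (t + 2)) • (v t - x t)` starting at
`x 0 ∈ C`, where `v t ∈ C` is a linear minimizer of `⟪∇f(x t), ·⟫` over `C`,
the primal gap satisfies `f (x t) - f xstar ≤ 2 L D² / (t + 1)` for all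
`t ≥ 1`. -/
theorem frankWolfe_agnostic_convergence
    {E : Type*} [NormedAddCommGroup E] [InnerProductSpace ℝ E] [CompleteSpace E]
    {C : Set E} (hCne : C.Nonempty) (hCcomp : IsCompact C) (hCconv : Convex ℝ C)
    (D : ℝ) (hD : D = Metric.diam C)
    {f : E → ℝ} {f' : E → E} {L : ℝ} (hL : 0 ≤ L)
    (hfconv : ConvexOn ℝ C f)
    (hfdiff : ∀ y ∈ C, HasGradientAt f (f' y) y)
    (hlip : ∀ y ∈ C, ∀ z ∈ C, ‖f' y - f' z‖ ≤ L * ‖y - z‖)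
    {xstar : E} (hxstar : xstar ∈ C) (hmin : ∀ u ∈ C, f xstar ≤ f u)
    (x v : ℕ → E) (hx0 : x 0 ∈ C)
    (hlmoC : ∀ t, v t ∈ C)
    (hlmo : ∀ t, ∀ u ∈ C, ⟪f' (x t), v t⟫ ≤ ⟪f' (x t), u⟫)
    (hrec : ∀ t : ℕ, x (t + 1) = x t + (2 / ((t : ℝ) + 2)) • (v t - x t)) :
    ∀ t : ℕ, 1 ≤ t → f (x t) - f xstar ≤ 2 * L * D ^ 2 / ((t : ℝ) + 1) := by
  have hxC : ∀ t, x t ∈ C := by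
    intro t
    induction t with
    | zero => exact hx0
    | succ t ih =>
      rw [hrec]
      refine fw_mem hCconv ih (hlmoC t) (by positivity) ?_
      rw [div_le_one (by positivity)]
      linarith [(Nat.cast_nonneg t : (0 : ℝ) ≤ t)]
  have hstep : ∀ t : ℕ, f (x (t + 1)) - f xstar ≤
      (1 - 2 / ((t : ℝ) + 2)) * (f (x t) - f xstar)
        + L / 2 * (2 / ((t : ℝ) + 2)) ^ 2 * D ^ 2 := by
    intro t
    have ht : (0 : ℝ) ≤ t := Nat.cast_nonneg t
    have g0 : 0 ≤ 2 / ((t : ℝ) + 2) := by positivity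
    have g1 : 2 / ((t : ℝ) + 2) ≤ 1 := by
      rw [div_le_one (by positivity)]
      linarith
    have h1 := fw_descent hCconv hfdiff hlip (hxC t) (hlmoC t) g0 g1
    rw [← hrec] at h1
    have h2 := fw_convex hfconv (hxC t) hxstar (hfdiff _ (hxC t))
    have h3 := hlmo t xstar hxstar
    rw [inner_sub_right] at h1 h2
    have h4 : ‖v t - x t‖ ≤ D := by
      rw [hD, ← dist_eq_norm]
      exact Metric.dist_le_diam_of_mem hCcomp.isBounded (hlmoC t) (hxC t)
    have h5 : ‖v t - x t‖ ^ 2 ≤ D ^ 2 := pow_le_pow_left₀ (norm_nonneg _) h4 2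
    generalize 2 / ((t : ℝ) + 2) = γ at *
    have h6 : L / 2 * γ ^ 2 * ‖v t - x t‖ ^ 2 ≤ L / 2 * γ ^ 2 * D ^ 2 :=
      mul_le_mul_of_nonneg_left h5 (by positivity)
    have h7 : γ * (⟪f' (x t), v t⟫ - ⟪f' (x t), x t⟫) ≤ γ * (f xstar - f (x t)) :=
      mul_le_mul_of_nonneg_left (by linarith) g0
    linarith
  have hLD : 0 ≤ L * D ^ 2 := by positivity
  intro t ht
  induction t, ht using Nat.le_induction with
  | base =>
    have := hstep 0
    norm_num at this ⊢
    linarith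
  | succ t ht ih =>
    refine (hstep t).trans ?_
    have ht0 : (0 : ℝ) ≤ t := Nat.cast_nonneg t
    have e : 1 - 2 / ((t : ℝ) + 2) = t / (t + 2) := by field_simp; ring
    rw [e]
    have h1 := mul_le_mul_of_nonneg_left ih (by positivity : 0 ≤ (t : ℝ) / (t + 2))
    have h2 : 2 * L * D ^ 2 / (((t + 1 : ℕ) : ℝ) + 1)
        - ((t : ℝ) / (t + 2) * (2 * L * D ^ 2 / ((t : ℝ) + 1))
          + L / 2 * (2 / ((t : ℝ) + 2)) ^ 2 * D ^ 2)
        = (L * D ^ 2) * (2 / ((t + 1) * (t + 2) ^ 2)) := by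
      have : ((t : ℝ) + 1 + 1) = t + 2 := by ring
      push_cast
      rw [this]
      field_simp
      ring
    have h3 : 0 ≤ (L * D ^ 2) * (2 / (((t : ℝ) + 1) * (t + 2) ^ 2)) := by positivity
    linarith
end
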